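/- Let (X,τ) be a topological space in which every singleton is nowhere dense (i.e., X₁ = X). Then a subset of X is sg-closed if and only if it is semi-closed, and consequently (X,τ) is sg-compact if and only if it is semi-compact. -/

import Mathlib

open Set TopologicalSpace

/-- A set is semi-open if it is contained in the closure of its interior. -/
def SemiOpen {X : Type*} [TopologicalSpace X] (A : Set X) : Prop :=
  A ⊆ closure (interior A)

/-- A set is semi-closed if the interior of its closure is contained in it. -/
def SemiClosed {X : Type*} [TopologicalSpace X] (A : Set X) : Prop :=
  interior (closure A) ⊆ A

/-- The semi-closure of a set: intersection of all semi-closed supersets. -/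
def sCl {X : Type*} [TopologicalSpace X] (A : Set X) : Set X :=
  ⋂₀ {B | SemiClosed B ∧ A ⊆ B}

/-- A set is sg-closed if its semi-closure is contained in every semi-open superset. -/
def SgClosed {X : Type*} [TopologicalSpace X] (A : Set X) : Prop :=
  ∀ U : Set X, SemiOpen U → A ⊆ U → sCl A ⊆ U

/-- A set is sg-open if its complement is sg-closed. -/
def SgOpen {X : Type*} [TopologicalSpace X] (A : Set X) : Prop :=
  SgClosed Aᶜ

/-- A set is hereditarily sg-closed if every subset of it is sg-closed. -/
def HSgClosed {X : Type*} [TopologicalSpace X] (A : Set X) : Prop :=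
  ∀ B ⊆ A, SgClosed B

/-- A space is sg-compact if every cover by sg-open sets has a finite subcover. -/
def SgCompact (X : Type*) [TopologicalSpace X] : Prop :=
  ∀ 𝒰 : Set (Set X), (∀ U ∈ 𝒰, SgOpen U) → ⋃₀ 𝒰 = univ →
    ∃ ℱ ⊆ 𝒰, ℱ.Finite ∧ ⋃₀ ℱ = univ

/-- A space is semi-compact if every cover by semi-open sets has a finite subcover. -/
def SemiCompact (X : Type*) [TopologicalSpace X] : Prop :=
  ∀ 𝒰 : Set (Set X), (∀ U ∈ 𝒰, SemiOpen U) → ⋃₀ 𝒰 = univ →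
    ∃ ℱ ⊆ 𝒰, ℱ.Finite ∧ ⋃₀ ℱ = univ

/-- A C₂-space: every nowhere dense subset is finite. -/
def C2Space (X : Type*) [TopologicalSpace X] : Prop :=
  ∀ A : Set X, interior (closure A) = ∅ → A.Finite

/-- A C₃-space: every hereditarily sg-closed subset is finite. -/
def C3Space (X : Type*) [TopologicalSpace X] : Prop :=
  ∀ A : Set X, HSgClosed A → A.Finite

/-- A set is regular open if it equals the interior of its closure. -/
def RegularOpen {X : Type*} [TopologicalSpace X] (A : Set X) : Prop :=
  A = interior (closure A)

/-- A set is δ-open if it is a union of regular open sets. -/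
def DeltaOpen {X : Type*} [TopologicalSpace X] (A : Set X) : Prop :=
  ∃ 𝒞 : Set (Set X), (∀ R ∈ 𝒞, RegularOpen R) ∧ A = ⋃₀ 𝒞

theorem SemiClosed.sgClosed {X : Type*} [TopologicalSpace X] {A : Set X}
    (hA : SemiClosed A) : SgClosed A :=
  fun _ _ hAU => fun _ hx => hAU (hx _ ⟨hA, Subset.rfl⟩)

theorem interior_closure_subset_sCl {X : Type*} [TopologicalSpace X] (A : Set X) :
    interior (closure A) ⊆ sCl A :=
  subset_sInter fun _ hB => (interior_mono (closure_mono hB.2)).trans hB.1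

theorem semiOpen_compl_of_interior_closure_eq_empty {X : Type*} [TopologicalSpace X]
    {A : Set X} (hA : interior (closure A) = ∅) : SemiOpen Aᶜ := by
  simp [SemiOpen, interior_compl, closure_compl, hA]

theorem semiClosed_compl_iff {X : Type*} [TopologicalSpace X] {A : Set X} :
    SemiClosed Aᶜ ↔ SemiOpen A := by
  simp [SemiOpen, SemiClosed, closure_compl, interior_compl]

theorem SgClosed.semiClosed {X : Type*} [TopologicalSpace X]
    (h : ∀ x : X, interior (closure {x}) = ∅) {A : Set X} (hA : SgClosed A) :
    SemiClosed A := by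
  intro x hx
  by_contra hxA
  exact hA {x}ᶜ (semiOpen_compl_of_interior_closure_eq_empty (h x))
    (subset_compl_singleton_iff.2 hxA) (interior_closure_subset_sCl A hx) rfl

/-- If every singleton of `X` is nowhere dense (`X₁ = X`), then
sg-closed = semi-closed, and `X` is sg-compact iff it is semi-compact. -/
theorem stmt_13 {X : Type*} [TopologicalSpace X]
    (h : ∀ x : X, interior (closure {x}) = ∅) :
    (∀ A : Set X, SgClosed A ↔ SemiClosed A) ∧
    (SgCompact X ↔ SemiCompact X) := by
  have hiff : ∀ A : Set X, SgClosed A ↔ SemiClosed A :=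
    fun _ => ⟨SgClosed.semiClosed h, SemiClosed.sgClosed⟩
  refine ⟨hiff, ?_⟩
  simp only [SgCompact, SemiCompact, SgOpen, hiff, semiClosed_compl_iff]
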